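/- arXiv:2507.04460 — 2 statements merged into one kernel-verified Lean document; each statement's English description precedes it below -/
import Mathlib

section
/- Let A be a finite-dimensional algebra over a field k and let k̄ be an algebraic closure of k. Then the injective dimension of A as a left module over itself equals the injective dimension of k̄ ⊗_k A as a left module over itself (as elements of ℕ ∪ {∞}). -/
universe u

/-- `IDimLE A n M`: the `A`-module `M` has injective dimension at most `n`,
witnessed by an injective coresolution of length at most `n`. -/
def IDimLE (A : Type u) [Ring A] : ℕ → (M : Type u) → [AddCommGroup M] → [Module A M] → Prop
  | 0, M, _, _ => Module.Injective A M
  | n + 1, M, _, _ =>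
      ∃ (I : Type u) (_ : AddCommGroup I) (_ : Module A I) (f : M →ₗ[A] I),
        Module.Injective A I ∧ Function.Injective f ∧ IDimLE A n (I ⧸ LinearMap.range f)

section Bridge
open CategoryTheory

variable {A : Type u} [Ring A]

theorem IDimLE_iff_has (n : ℕ) : ∀ (M : Type u) [AddCommGroup M] [Module A M],
    IDimLE A n M ↔ HasInjectiveDimensionLE (ModuleCat.of A M) n := by
  induction n with
  | zero =>
    intro M _ _
    exact (Module.injective_iff_injective_object A M).trans
      injective_iff_hasInjectiveDimensionLT_one
  | succ n ih =>
    intro M _ _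
    have key : ∀ (I : Type u) [AddCommGroup I] [Module A I] (f : M →ₗ[A] I),
        Module.Injective A I → Function.Injective f →
        (HasInjectiveDimensionLE (ModuleCat.of A (I ⧸ LinearMap.range f)) n ↔
          HasInjectiveDimensionLE (ModuleCat.of A M) (n + 1)) := by
      intro I _ _ f hI hf
      let S : ShortComplex (ModuleCat.{u} A) :=
        ShortComplex.mk (ModuleCat.ofHom f) (ModuleCat.ofHom (LinearMap.range f).mkQ) (by
          ext x; simp)
      have hS : S.ShortExact := by
        refine { exact := ?_, mono_f := ?_, epi_g := ?_ }
        · rw [ShortComplex.ShortExact.moduleCat_exact_iff_function_exact]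
          exact LinearMap.exact_map_mkQ_range f
        · exact (ModuleCat.mono_iff_injective _).2 hf
        · exact (ModuleCat.epi_iff_surjective _).2 (Submodule.mkQ_surjective _)
      exact hS.hasInjectiveDimensionLT_X₃_iff n
        ((Module.injective_iff_injective_object A I).1 hI)
    constructor
    · rintro ⟨I, _, _, f, hI, hf, h⟩
      exact (key I f hI hf).1 ((ih _).1 h)
    · intro h
      let P := Injective.under (ModuleCat.of A M)
      have hP : Injective P := inferInstance
      let f : M →ₗ[A] P := (Injective.ι (ModuleCat.of A M)).hom
      have hf : Function.Injective f := (ModuleCat.mono_iff_injective _).1 inferInstance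
      have hI : Module.Injective A P := (Module.injective_iff_injective_object A P).2 hP
      exact ⟨P, inferInstance, inferInstance, f, hI, hf, (ih _).2 ((key P f hI hf).2 h)⟩

theorem IDimLE_retract {n : ℕ} {M N : Type u} [AddCommGroup M] [Module A M] [AddCommGroup N]
    [Module A N] (s : M →ₗ[A] N) (r : N →ₗ[A] M) (h : ∀ x, r (s x) = x)
    (hN : IDimLE A n N) : IDimLE A n M := by
  rw [IDimLE_iff_has] at hN ⊢
  let R : Retract (ModuleCat.of A M) (ModuleCat.of A N) :=
    { i := ModuleCat.ofHom s, r := ModuleCat.ofHom r, retract := by ext x; simp [h] }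
  exact R.hasInjectiveDimensionLT _

theorem IDimLE_congr {n : ℕ} {M N : Type u} [AddCommGroup M] [Module A M] [AddCommGroup N]
    [Module A N] (e : M ≃ₗ[A] N) (hN : IDimLE A n N) : IDimLE A n M :=
  IDimLE_retract e.toLinearMap e.symm.toLinearMap (by simp) hN

theorem IDimLE_succ {n : ℕ} {M I C : Type u} [AddCommGroup M] [Module A M] [AddCommGroup I]
    [Module A I] [AddCommGroup C] [Module A C] (f : M →ₗ[A] I) (g : I →ₗ[A] C)
    (hI : Module.Injective A I) (hf : Function.Injective f) (hg : Function.Surjective g)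
    (hfg : Function.Exact f g) (hC : IDimLE A n C) : IDimLE A (n + 1) M := by
  refine ⟨I, inferInstance, inferInstance, f, hI, hf, ?_⟩
  refine IDimLE_congr ?_ hC
  exact (Submodule.quotEquivOfEq _ _ (LinearMap.exact_iff.1 hfg).symm).trans
    (g.quotKerEquivOfSurjective hg)

end Bridge

section BC

open TensorProduct

variable (k K A : Type u) [Field k] [Field K] [Algebra k K] [Ring A] [Algebra k A]

/-- base change of a module -/
def BC (M : Type u) [AddCommGroup M] [Module k M] : Type u := K ⊗[k] M

noncomputable instance (M : Type u) [AddCommGroup M] [Module k M] : AddCommGroup (BC k K M) :=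
  inferInstanceAs (AddCommGroup (K ⊗[k] M))

noncomputable instance (M : Type u) [AddCommGroup M] [Module k M] : Module k (BC k K M) :=
  inferInstanceAs (Module k (K ⊗[k] M))

variable (M : Type u) [AddCommGroup M] [Module k M] [Module A M] [IsScalarTower k A M]

/-- action -/
noncomputable def BCact : K ⊗[k] A →ₐ[k] Module.End k (K ⊗[k] M) :=
  (Module.endTensorEndAlgHom (R := k) (S := k) (A := k) (M := K) (N := M)).comp
    (Algebra.TensorProduct.map (Algebra.lmul k K) (Algebra.lsmul k k M))

noncomputable instance : Module (K ⊗[k] A) (BC k K M) :=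
  Module.compHom (K ⊗[k] M) (BCact k K A M).toRingHom

variable {k K A M}

/-- pure tensors -/
def bmk (d : K) (x : M) : BC k K M := d ⊗ₜ[k] x

theorem BC_smul (c d : K) (a : A) (x : M) :
    ((c ⊗ₜ[k] a : K ⊗[k] A) • (bmk d x : BC k K M) : BC k K M) = bmk (c * d) (a • x) := by
  change BCact k K A M (c ⊗ₜ a) (d ⊗ₜ x) = _
  simp only [BCact, AlgHom.comp_apply, Algebra.TensorProduct.map_tmul]
  erw [Module.endTensorEndAlgHom_apply]
  rfl

theorem BC_ind {P : BC k K M → Prop} (h0 : P 0)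
    (ht : ∀ (c : K) (x : M), P (bmk c x))
    (ha : ∀ x y, P x → P y → P (x + y)) (z : BC k K M) : P z :=
  TensorProduct.induction_on (motive := P) z h0 ht ha

theorem BC_ksmul (r : k) (w : BC k K M) :
    r • w = (algebraMap k K r ⊗ₜ[k] (1 : A) : K ⊗[k] A) • w := by
  induction w using BC_ind with
  | h0 => simp
  | ht c x =>
    rw [BC_smul, one_smul, ← Algebra.smul_def]
    rfl
  | ha x y hx hy => rw [smul_add, smul_add, hx, hy]

/-- additive maps out of the base change -/
def BCadd {Q : Type u} [AddCommGroup Q] [Module k Q] (F : K ⊗[k] M →ₗ[k] Q) : BC k K M →+ Q where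
  toFun := F
  map_zero' := F.map_zero
  map_add' := F.map_add

theorem BCadd_mk {Q : Type u} [AddCommGroup Q] [Module k Q] (F : K ⊗[k] M →ₗ[k] Q)
    (c : K) (x : M) : BCadd F (bmk c x) = F (c ⊗ₜ x) := rfl

/-- Build a linear map over `K ⊗ A` -/
def mkLin {X Y : Type u} [AddCommGroup X] [AddCommGroup Y] [Module (K ⊗[k] A) X]
    [Module (K ⊗[k] A) Y] (F : X →+ Y)
    (h : ∀ (c : K) (a : A) x, F ((c ⊗ₜ[k] a : K ⊗[k] A) • x) = (c ⊗ₜ[k] a : K ⊗[k] A) • F x) :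
    X →ₗ[K ⊗[k] A] Y :=
  { F with
    map_smul' := by
      intro b x
      change F (b • x) = b • F x
      induction b using TensorProduct.induction_on with
      | zero => simp
      | tmul c a => exact h c a x
      | add b c hb hc => rw [add_smul, map_add, hb, hc, add_smul] }

variable {N : Type u} [AddCommGroup N] [Module k N] [Module A N] [IsScalarTower k A N]

/-- functoriality -/
noncomputable def BCmap (f : M →ₗ[A] N) : BC k K M →ₗ[K ⊗[k] A] BC k K N :=
  mkLin (BCadd (Q := BC k K N)
    (LinearMap.lTensor K (f.restrictScalars k) : K ⊗[k] M →ₗ[k] K ⊗[k] N)) (by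
    intro c a x
    induction x using BC_ind with
    | h0 => simp
    | ht d x =>
      rw [BC_smul]
      change bmk (c * d) (f (a • x)) = (c ⊗ₜ[k] a : K ⊗[k] A) • (bmk d (f x) : BC k K N)
      rw [BC_smul, map_smul]
    | ha x y hx hy => rw [smul_add, map_add, map_add, hx, hy, smul_add])

theorem BCmap_inj (f : M →ₗ[A] N) (hf : Function.Injective f) :
    Function.Injective (BCmap (k := k) (K := K) f) :=
  Module.Flat.lTensor_preserves_injective_linearMap (M := K) (f.restrictScalars k) hf

theorem BCmap_surj (f : M →ₗ[A] N) (hf : Function.Surjective f) :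
    Function.Surjective (BCmap (k := k) (K := K) f) :=
  LinearMap.lTensor_surjective (g := f.restrictScalars k) K hf

theorem BCmap_exact {L : Type u} [AddCommGroup L] [Module k L] [Module A L]
    [IsScalarTower k A L] (f : M →ₗ[A] N) (g : N →ₗ[A] L) (hfg : Function.Exact f g)
    (hg : Function.Surjective g) :
    Function.Exact (BCmap (k := k) (K := K) f) (BCmap (k := k) (K := K) g) :=
  lTensor_exact (f := f.restrictScalars k) (g := g.restrictScalars k) K hfg hg

/-! restriction -/

theorem inj_restrict (Q : Type u) [AddCommGroup Q] [Module A Q] [Module (K ⊗[k] A) Q]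
    (h : ∀ (a : A) (x : Q), ((1 : K) ⊗ₜ[k] a : K ⊗[k] A) • x = a • x)
    (hQ : Module.Injective (K ⊗[k] A) Q) : Module.Injective A Q := by
  constructor
  intro X Y _ _ _ _ f hf g
  let _ : Module k X := Module.compHom X (algebraMap k A)
  let _ : Module k Y := Module.compHom Y (algebraMap k A)
  let _ : Module k Q := Module.compHom Q (algebraMap k A)
  have _ : IsScalarTower k A X := ⟨fun c a x => by
    rw [Algebra.smul_def, mul_smul]; rfl⟩
  have _ : IsScalarTower k A Y := ⟨fun c a x => by
    rw [Algebra.smul_def, mul_smul]; rfl⟩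
  have _ : IsScalarTower k A Q := ⟨fun c a x => by
    rw [Algebra.smul_def, mul_smul]; rfl⟩
  have hk : ∀ (c : k) (x : Q), c • x = (1 ⊗ₜ[k] algebraMap k A c : K ⊗[k] A) • x := by
    intro c x; rw [h]; rfl
  have hk2 : ∀ (c : k), (1 ⊗ₜ[k] algebraMap k A c : K ⊗[k] A) = c • 1 := by
    intro c
    rw [Algebra.algebraMap_eq_smul_one, tmul_smul]; rfl
  let G0 : K →ₗ[k] X →ₗ[k] Q := LinearMap.mk₂ k (fun c x => (c ⊗ₜ[k] (1 : A) : K ⊗[k] A) • g x)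
    (by intro c d x; rw [add_tmul, add_smul])
    (by intro r c x; rw [hk, hk2, smul_smul, smul_mul_assoc, one_mul, smul_tmul'])
    (by intro c x y; rw [map_add, smul_add])
    (by
      intro r c x
      rw [hk, hk2, smul_smul, LinearMap.map_smul_of_tower, hk, hk2, smul_smul]
      simp)
  let G1 : K ⊗[k] X →ₗ[k] Q := TensorProduct.lift G0
  have hG1 : ∀ c x, G1 (c ⊗ₜ x) = (c ⊗ₜ[k] (1 : A) : K ⊗[k] A) • g x := fun c x => by
    simp [G1, G0]
  let G : BC k K X →ₗ[K ⊗[k] A] Q := mkLin (BCadd G1) (by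
    intro c a x
    induction x using BC_ind with
    | h0 => simp
    | ht d x =>
      rw [BC_smul]
      rw [BCadd_mk, BCadd_mk, hG1, hG1, map_smul, ← h, smul_smul, smul_smul]
      simp
    | ha x y hx hy => rw [smul_add, map_add, map_add, hx, hy, smul_add])
  obtain ⟨H, hH⟩ := hQ.out (BCmap (k := k) (K := K) f) (BCmap_inj f hf) G
  refine ⟨{ toFun := fun y => H (bmk (1 : K) y)
            map_add' := ?_, map_smul' := ?_ }, ?_⟩
  · intro y z
    rw [← map_add]
    exact congrArg H (tmul_add (1 : K) y z)
  · intro a y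
    rw [RingHom.id_apply, ← h, ← map_smul, BC_smul, one_mul]
  · intro x
    have := hH (bmk (1 : K) x)
    refine Eq.trans ?_ (this.trans ?_)
    · rfl
    · change G1 ((1 : K) ⊗ₜ x) = _
      rw [hG1]
      exact one_smul (K ⊗[k] A) _

theorem IDimLE_restrict (n : ℕ) : ∀ (Q : Type u) [AddCommGroup Q] [Module A Q]
    [Module (K ⊗[k] A) Q]
    (_ : ∀ (a : A) (x : Q), ((1 : K) ⊗ₜ[k] a : K ⊗[k] A) • x = a • x)
    (_ : IDimLE (K ⊗[k] A) n Q), IDimLE A n Q := by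
  induction n with
  | zero => exact fun Q _ _ _ h hQ => inj_restrict Q h hQ
  | succ n ih =>
    rintro Q _ _ _ h ⟨I, _, _, f, hI, hf, hC⟩
    let φ : A →+* K ⊗[k] A :=
      (Algebra.TensorProduct.includeRight : A →ₐ[k] K ⊗[k] A).toRingHom
    let _ : Module A I := Module.compHom I φ
    let _ : Module A (I ⧸ LinearMap.range f) := Module.compHom _ φ
    let f' : Q →ₗ[A] I := { f with
      map_smul' := by
        intro a x
        change f (a • x) = φ a • f x
        rw [← h, map_smul]; rfl }
    let g' : I →ₗ[A] (I ⧸ LinearMap.range f) := { (LinearMap.range f).mkQ with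
      map_smul' := fun a x => (LinearMap.range f).mkQ.map_smul (φ a) x }
    exact IDimLE_succ f' g' (inj_restrict I (fun _ _ => rfl) hI) hf
      (Submodule.mkQ_surjective (LinearMap.range f)) (LinearMap.exact_map_mkQ_range f)
      (ih _ (fun _ _ => rfl) hC)

/-! base change of injectives -/

variable (k A M) in
/-- coinduced module -/
def CoInd : Type u := A →ₗ[k] M

instance : AddCommGroup (CoInd k A M) := inferInstanceAs (AddCommGroup (A →ₗ[k] M))

instance : Module A (CoInd k A M) where
  smul a f := LinearMap.comp (show A →ₗ[k] M from f) (LinearMap.mulRight k a)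
  one_smul f := LinearMap.ext fun x => congrArg (show A →ₗ[k] M from f) (mul_one x)
  mul_smul a b f := LinearMap.ext fun x =>
    congrArg (show A →ₗ[k] M from f) (mul_assoc x a b).symm
  smul_zero a := rfl
  smul_add a f g := rfl
  add_smul a b f := LinearMap.ext fun x =>
    (congrArg (show A →ₗ[k] M from f) (mul_add x a b)).trans (map_add _ _ _)
  zero_smul f := LinearMap.ext fun x =>
    (congrArg (show A →ₗ[k] M from f) (mul_zero x)).trans (map_zero _)

theorem exists_rho (hM : Module.Injective A M) :
    ∃ ρ : (A →ₗ[k] M) →ₗ[k] M,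
      (∀ (a : A) (f : A →ₗ[k] M), ρ (f ∘ₗ LinearMap.mulRight k a) = a • ρ f) ∧
      ∀ x : M, ρ ((LinearMap.toSpanSingleton A M x).restrictScalars k) = x := by
  let ι : M →ₗ[A] CoInd k A M :=
    { toFun := fun x => (LinearMap.toSpanSingleton A M x).restrictScalars k
      map_add' := fun x y => LinearMap.ext fun a => smul_add a x y
      map_smul' := fun b x => LinearMap.ext fun a => (mul_smul a b x).symm }
  have hι : Function.Injective ι := by
    intro x y hxy
    have := congrArg (fun f : A →ₗ[k] M => f 1) hxy
    exact (one_smul A x).symm.trans (this.trans (one_smul A y))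
  obtain ⟨r, hr⟩ := hM.out ι hι LinearMap.id
  refine ⟨{ toFun := fun f => r f, map_add' := fun f g => map_add r _ _, map_smul' := ?_ },
    fun a f => map_smul r a (show CoInd k A M from f), hr⟩
  intro c f
  have : (show CoInd k A M from c • f) = (algebraMap k A c) • (show CoInd k A M from f) :=
    LinearMap.ext fun x => by
      change c • f x = f (x * algebraMap k A c)
      rw [← Algebra.commutes, ← Algebra.smul_def, map_smul]
  change r (show CoInd k A M from c • f) = c • r _
  rw [this, map_smul, algebraMap_smul]

theorem BC_injective [FiniteDimensional k A] (hM : Module.Injective A M) :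
    Module.Injective (K ⊗[k] A) (BC k K M) := by
  obtain ⟨ρ, h1, h2⟩ := exists_rho (k := k) hM
  let Θ : K ⊗[k] (A →ₗ[k] M) ≃ₗ[k] (A →ₗ[k] BC k K M) := lTensorHomEquivHomLTensor k A K M
  have hΘ : ∀ c f a, Θ (c ⊗ₜ f) a = bmk c (f a) := by
    intro c f a
    change lTensorHomEquivHomLTensor k A K M (c ⊗ₜ f) a = _
    rw [lTensorHomEquivHomLTensor_apply]
    rfl
  let L : K ⊗[k] (A →ₗ[k] M) →ₗ[k] BC k K M := LinearMap.lTensor K ρ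
  let ρ' : (A →ₗ[k] BC k K M) →ₗ[k] BC k K M := L ∘ₗ Θ.symm.toLinearMap
  have hρ' : ∀ c f, ρ' (Θ (c ⊗ₜ f)) = bmk c (ρ f) := by
    intro c f
    change L (Θ.symm (Θ _)) = _
    rw [LinearEquiv.symm_apply_apply]
    rfl
  -- equivariance
  have e1 : ∀ (c : K) (a : A) (φ ψ : A →ₗ[k] BC k K M),
      (∀ x, ψ x = (c ⊗ₜ[k] (1 : A) : K ⊗[k] A) • φ (x * a)) →
      ρ' ψ = (c ⊗ₜ[k] a : K ⊗[k] A) • ρ' φ := by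
    intro c a φ
    obtain ⟨t, rfl⟩ := Θ.surjective φ
    induction t using TensorProduct.induction_on with
    | zero =>
      intro ψ h
      have : ψ = 0 := LinearMap.ext fun x => by rw [h]; simp
      rw [this]; simp
    | tmul d f =>
      intro ψ h
      have : ψ = Θ ((c * d) ⊗ₜ (f ∘ₗ LinearMap.mulRight k a)) := LinearMap.ext fun x => by
        rw [h, hΘ, hΘ, BC_smul, one_smul]; rfl
      rw [this, hρ', hρ', BC_smul, ← h1]
    | add s t hs ht =>
      intro ψ h
      let tw : (A →ₗ[k] BC k K M) → (A →ₗ[k] BC k K M) := fun φ =>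
        { toFun := fun x => (c ⊗ₜ[k] (1 : A) : K ⊗[k] A) • φ (x * a)
          map_add' := fun x y => by rw [add_mul, map_add, smul_add]
          map_smul' := fun r x => by
            rw [smul_mul_assoc, map_smul, RingHom.id_apply, BC_ksmul (A := A), smul_smul,
              BC_ksmul (A := A), smul_smul]
            simp [mul_comm] }
      have : ψ = tw (Θ s) + tw (Θ t) := LinearMap.ext fun x => by
        rw [h, map_add, LinearMap.add_apply, smul_add]; rfl
      rw [this, map_add, hs (tw (Θ s)) (fun _ => rfl), ht (tw (Θ t)) (fun _ => rfl), map_add, map_add, smul_add]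
  have e2 : ∀ (w : BC k K M) (φ : A →ₗ[k] BC k K M),
      (∀ a, φ a = (1 ⊗ₜ[k] a : K ⊗[k] A) • w) → ρ' φ = w := by
    intro w
    induction w using BC_ind with
    | h0 =>
      intro φ h
      have : φ = 0 := LinearMap.ext fun a => (h a).trans (smul_zero _)
      rw [this]; exact map_zero ρ'
    | ht c x =>
      intro φ h
      have : φ = Θ (c ⊗ₜ ((LinearMap.toSpanSingleton A M x).restrictScalars k)) :=
        LinearMap.ext fun a => by
          rw [h, BC_smul, hΘ, one_mul]; rfl
      rw [this, hρ', h2]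
    | ha x y hx hy =>
      intro φ h
      let act : BC k K M → (A →ₗ[k] BC k K M) := fun x =>
        { toFun := fun a => (1 ⊗ₜ[k] a : K ⊗[k] A) • x
          map_add' := fun a b => by
            rw [tmul_add, add_smul]
          map_smul' := fun r a => by
            rw [RingHom.id_apply, BC_ksmul (A := A), smul_smul, Algebra.algebraMap_eq_smul_one]
            simp [smul_tmul'] }
      have : φ = act x + act y := LinearMap.ext fun a => by
        rw [h, smul_add]; rfl
      rw [this, map_add, hx _ (fun _ => rfl), hy _ (fun _ => rfl)]
  constructor
  intro X Y _ _ _ _ f hf g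
  let φ : K →+* K ⊗[k] A := Algebra.TensorProduct.includeLeftRingHom
  let _ : Module K X := Module.compHom X φ
  let _ : Module K Y := Module.compHom Y φ
  let fK : X →ₗ[K] Y := { f with map_smul' := fun c x => f.map_smul (φ c) x }
  obtain ⟨p, hp⟩ := LinearMap.exists_leftInverse_of_injective fK (LinearMap.ker_eq_bot.2 hf)
  have hp' : ∀ x, p (f x) = x := fun x => LinearMap.congr_fun hp x
  let h : Y →+ BC k K M := g.toAddMonoidHom.comp p.toAddMonoidHom
  have hh : ∀ (c : K) (y : Y), h ((c ⊗ₜ[k] (1 : A) : K ⊗[k] A) • y) =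
      (c ⊗ₜ[k] (1 : A) : K ⊗[k] A) • h y := by
    intro c y
    exact (congrArg g (p.map_smul c y)).trans (g.map_smul (φ c) _)
  have hhf : ∀ x, h (f x) = g x := fun x => congrArg g (hp' x)
  let Φ : Y → (A →ₗ[k] BC k K M) := fun y =>
    { toFun := fun a => h ((1 ⊗ₜ[k] a : K ⊗[k] A) • y)
      map_add' := fun a b => by
        rw [tmul_add, add_smul, map_add]
      map_smul' := fun r a => by
        rw [RingHom.id_apply, BC_ksmul (A := A), ← hh, smul_smul,
          Algebra.algebraMap_eq_smul_one]
        simp [smul_tmul'] }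
  let H : Y →+ BC k K M :=
    { toFun := fun y => ρ' (Φ y)
      map_zero' := by
        have : Φ 0 = 0 := LinearMap.ext fun a => by
          change h _ = 0
          rw [smul_zero, map_zero]
        rw [this, map_zero]
      map_add' := fun y z => by
        have : Φ (y + z) = Φ y + Φ z := LinearMap.ext fun a => by
          change h _ = h _ + h _
          rw [smul_add, map_add]
        rw [this, map_add] }
  refine ⟨mkLin H ?_, ?_⟩
  · intro c a y
    refine e1 c a _ _ fun x => ?_
    change h _ = _ • h _
    rw [← hh, smul_smul, smul_smul]
    simp
  · intro x
    refine e2 _ _ fun a => ?_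
    change h _ = _
    rw [← map_smul, hhf, map_smul]

theorem IDimLE_BC [FiniteDimensional k A] (n : ℕ) : ∀ (M : Type u) [AddCommGroup M] [Module k M]
    [Module A M] [IsScalarTower k A M] (_ : IDimLE A n M),
    IDimLE (K ⊗[k] A) n (BC k K M) := by
  induction n with
  | zero => exact fun M _ _ _ _ h => BC_injective h
  | succ n ih =>
    rintro M _ _ _ _ ⟨I, _, _, f, hI, hf, hC⟩
    let _ : Module k I := Module.compHom I (algebraMap k A)
    have _ : IsScalarTower k A I := ⟨fun c a x => by
      rw [Algebra.smul_def, mul_smul]; rfl⟩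
    exact IDimLE_succ (BCmap f) (BCmap (LinearMap.range f).mkQ) (BC_injective hI)
      (BCmap_inj f hf) (BCmap_surj _ (Submodule.mkQ_surjective _))
      (BCmap_exact _ _ (LinearMap.exact_map_mkQ_range f) (Submodule.mkQ_surjective _))
      (ih _ hC)

variable (k K A) in
/-- the regular module -/
noncomputable def BCself : (K ⊗[k] A) ≃ₗ[K ⊗[k] A] BC k K A :=
  LinearEquiv.ofBijective (mkLin (X := K ⊗[k] A) (Y := BC k K A)
    { toFun := fun x => x, map_zero' := rfl, map_add' := fun _ _ => rfl } (by
      intro c a x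
      induction x using TensorProduct.induction_on with
      | zero => simp
      | tmul d b =>
        change (_ : BC k K A) = (c ⊗ₜ[k] a : K ⊗[k] A) • (bmk d b : BC k K A)
        rw [BC_smul]
        exact Algebra.TensorProduct.tmul_mul_tmul c d a b
      | add x y hx hy => rw [smul_add, map_add, map_add, hx, hy, smul_add]))
    Function.bijective_id

theorem IDimLE_descend (n : ℕ) (h : IDimLE (K ⊗[k] A) n (BC k K M)) : IDimLE A n M := by
  let φ : A →+* K ⊗[k] A :=
    (Algebra.TensorProduct.includeRight : A →ₐ[k] K ⊗[k] A).toRingHom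
  let _ : Module A (BC k K M) := Module.compHom _ φ
  have hs : ∀ (a : A) (x : BC k K M), a • x = (1 ⊗ₜ[k] a : K ⊗[k] A) • x := fun _ _ => rfl
  obtain ⟨l, hl⟩ := LinearMap.exists_leftInverse_of_injective (Algebra.linearMap k K)
    (LinearMap.ker_eq_bot.2 (algebraMap k K).injective)
  have hl1 : l 1 = 1 := by
    have := LinearMap.congr_fun hl 1
    simpa using this
  let R : BC k K M →+ M := BCadd (TensorProduct.lid k M ∘ₗ LinearMap.rTensor M l)
  have hR : ∀ c x, R (bmk c x) = l c • x := fun c x => rfl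
  refine IDimLE_retract (N := BC k K M)
    { toFun := fun x => bmk 1 x
      map_add' := fun x y => tmul_add (1 : K) x y
      map_smul' := fun a x => by rw [RingHom.id_apply, hs, BC_smul, one_mul] }
    { R with
      map_smul' := fun a x => by
        change R (a • x) = a • R x
        rw [hs]
        induction x using BC_ind with
        | h0 => simp
        | ht c x => rw [BC_smul, hR, hR, one_mul, smul_comm]
        | ha x y hx hy => rw [smul_add, map_add, map_add, hx, hy, smul_add] }
    (fun x => ?_) (IDimLE_restrict n _ (fun _ _ => rfl) h)
  change R (bmk 1 x) = x
  rw [hR, hl1, one_smul]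

end BC

open TensorProduct in
/-- Let `A` be a finite-dimensional algebra over a field `k` and `k̄` an algebraic closure
of `k`. Then the self-injective dimension of `A` equals that of `k̄ ⊗_k A` (as elements of
`ℕ ∪ {∞}`; here: they are bounded by the same natural numbers). -/
theorem injDim_baseChange_algebraicClosure (k : Type u) [Field k] (A : Type u) [Ring A]
    [Algebra k A] [FiniteDimensional k A] :
    ∀ n : ℕ, IDimLE A n A ↔
      IDimLE (AlgebraicClosure k ⊗[k] A) n (AlgebraicClosure k ⊗[k] A) := by
  intro n
  constructor
  · intro h
    exact IDimLE_congr (BCself k (AlgebraicClosure k) A) (IDimLE_BC n A h)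
  · intro h
    exact IDimLE_descend n (IDimLE_congr (BCself k (AlgebraicClosure k) A).symm h)
end

section
/- Let A and B be finite-dimensional algebras over a field k, let F : A-mod → B-mod be an equivalence between their categories of finitely generated left modules, let Q be a finitely generated left A-module and let n ∈ ℕ. If (A, Q) is an n-Auslander pair, i.e., gldim A ≤ n ≤ Q-domdim_A A, then (B, FQ) is an n-Auslander pair, i.e., gldim B ≤ n ≤ (FQ)-domdim_B B. -/
universe u

/-- `PDimLE A n M`: the `A`-module `M` has projective dimension at most `n`,
witnessed by a projective resolution of length at most `n`. -/
def PDimLE (A : Type u) [Ring A] : ℕ → (M : Type u) → [AddCommGroup M] → [Module A M] → Prop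
  | 0, M, _, _ => Module.Projective A M
  | n + 1, M, _, _ =>
      ∃ (P : Type u) (_ : AddCommGroup P) (_ : Module A P) (f : P →ₗ[A] M),
        Module.Projective A P ∧ Function.Surjective f ∧ PDimLE A n (LinearMap.ker f)

/-- `MemAdd A Q X` : the `A`-module `X` belongs to `add Q`, i.e. `X` is (isomorphic to)
a direct summand of a finite direct sum of copies of `Q`. -/
def MemAdd (A : Type u) [Ring A] (Q : Type u) [AddCommGroup Q] [Module A Q]
    (X : Type u) [AddCommGroup X] [Module A X] : Prop :=
  ∃ (m : ℕ) (Y : Type u) (_ : AddCommGroup Y) (_ : Module A Y),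
    Nonempty ((X × Y) ≃ₗ[A] (Fin m → Q))

/-- `RelDomdimGE A Q M n` : the relative dominant dimension of `M` with respect to `Q` is
at least `n`, i.e. `n = 0` or there is an exact sequence
`0 → M → X 1 → X 2 → ⋯ → X n` with all `X i ∈ add Q` which remains exact after
applying `Hom_A(-, Q)`. -/
def RelDomdimGE (A : Type u) [Ring A] (Q : Type u) [AddCommGroup Q] [Module A Q]
    (M : Type u) [AddCommGroup M] [Module A M] (n : ℕ) : Prop :=
  n = 0 ∨
    ∃ (X : ℕ → Type u) (_ : ∀ i, AddCommGroup (X i)) (_ : ∀ i, Module A (X i))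
      (f : M →ₗ[A] X 1) (d : ∀ i, X i →ₗ[A] X (i + 1)),
      (∀ i, 1 ≤ i → i ≤ n → MemAdd A Q (X i)) ∧
      Function.Injective f ∧
      (2 ≤ n → Function.Exact f (d 1)) ∧
      (∀ i, 1 ≤ i → i + 2 ≤ n → Function.Exact (d i) (d (i + 1))) ∧
      Function.Surjective (fun h : X 1 →ₗ[A] Q => h.comp f) ∧
      (2 ≤ n → Function.Exact (fun h : X 2 →ₗ[A] Q => h.comp (d 1))
        (fun h : X 1 →ₗ[A] Q => h.comp f)) ∧
      (∀ i, 1 ≤ i → i + 2 ≤ n → Function.Exact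
        (fun h : X (i + 2) →ₗ[A] Q => h.comp (d (i + 1)))
        (fun h : X (i + 1) →ₗ[A] Q => h.comp (d i)))

section AuxCat
open CategoryTheory CategoryTheory.Limits
universe v1 u1 v2 u2
set_option linter.unusedSectionVars false

structure SESC {C : Type u1} [Category.{v1} C] [Preadditive C] {M X K : C}
    (f : M ⟶ X) (p : X ⟶ K) : Prop where
  mono : Mono f
  epi : Epi p
  zero : f ≫ p = 0
  lift : ∀ {T : C} (u : T ⟶ X), u ≫ p = 0 → ∃ v, v ≫ f = u
  desc : ∀ {T : C} (u : X ⟶ T), f ≫ u = 0 → ∃ v, p ≫ v = u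

def MemAddC {C : Type u1} [Category.{v1} C] [Preadditive C] (Q X : C) : Prop :=
  ∃ (ι : Type) (_ : Fintype ι) (a : ι → (X ⟶ Q)) (b : ι → (Q ⟶ X)), ∑ j, a j ≫ b j = 𝟙 X

def DomC {C : Type u1} [Category.{v1} C] [Preadditive C] (Q : C) : ℕ → C → Prop
  | 0, _ => True
  | n + 1, M => ∃ (X K : C) (f : M ⟶ X) (p : X ⟶ K), MemAddC Q X ∧ SESC f p ∧
      (∀ h : M ⟶ Q, ∃ h', f ≫ h' = h) ∧ DomC Q n K

def PDC {C : Type u1} [Category.{v1} C] [Preadditive C] : ℕ → C → Prop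
  | 0, M => Projective M
  | n + 1, M => ∃ (K P : C) (f : K ⟶ P) (p : P ⟶ M), Projective P ∧ SESC f p ∧ PDC n K

section
variable {C : Type u1} [Category.{v1} C] [Preadditive C]

lemma MemAddC.ext {Q X M Y : C} (hX : MemAddC Q X) (f : M ⟶ Y)
    (h : ∀ h : M ⟶ Q, ∃ h', f ≫ h' = h) (g : M ⟶ X) : ∃ g', f ≫ g' = g := by
  obtain ⟨ι, _, a, b, hab⟩ := hX
  choose H hH using fun j => h (g ≫ a j)
  refine ⟨∑ j, H j ≫ b j, ?_⟩
  rw [Preadditive.comp_sum]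
  simp only [← Category.assoc, hH]
  simp only [Category.assoc]
  rw [← Preadditive.comp_sum, hab, Category.comp_id]

variable [HasBinaryBiproducts C] [HasZeroObject C]

lemma MemAddC.biprod {Q X Y : C} (hX : MemAddC Q X) (hY : MemAddC Q Y) : MemAddC Q (X ⊞ Y) := by
  obtain ⟨ι, _, a, b, hab⟩ := hX
  obtain ⟨κ, _, c, d, hcd⟩ := hY
  refine ⟨ι ⊕ κ, inferInstance, Sum.elim (fun j => biprod.fst ≫ a j) (fun j => biprod.snd ≫ c j),
    Sum.elim (fun j => b j ≫ biprod.inl) (fun j => d j ≫ biprod.inr), ?_⟩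
  rw [Fintype.sum_sum_type]
  have h1 : ∑ j, (biprod.fst ≫ a j) ≫ (b j ≫ biprod.inl) = (biprod.fst ≫ biprod.inl : X ⊞ Y ⟶ X ⊞ Y) := by
    calc _ = biprod.fst ≫ (∑ j, a j ≫ b j) ≫ biprod.inl := by
          rw [Preadditive.sum_comp, Preadditive.comp_sum]; simp
      _ = _ := by rw [hab]; simp
  have h2 : ∑ j, (biprod.snd ≫ c j) ≫ (d j ≫ biprod.inr) = (biprod.snd ≫ biprod.inr : X ⊞ Y ⟶ X ⊞ Y) := by
    calc _ = biprod.snd ≫ (∑ j, c j ≫ d j) ≫ biprod.inr := by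
          rw [Preadditive.sum_comp, Preadditive.comp_sum]; simp
      _ = _ := by rw [hcd]; simp
  simp only [Sum.elim_inl, Sum.elim_inr, h1, h2, biprod.total]

lemma MemAddC.zero (Q : C) {Z : C} (hZ : IsZero Z) : MemAddC Q Z :=
  ⟨Empty, inferInstance, Empty.elim, Empty.elim, hZ.eq_of_src _ _⟩

lemma SESC.biprod {M X K M' X' K' : C} {f : M ⟶ X} {p : X ⟶ K} {f' : M' ⟶ X'} {p' : X' ⟶ K'}
    (h : SESC f p) (h' : SESC f' p') : SESC (biprod.map f f') (biprod.map p p') where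
  mono := by have := h.mono; have := h'.mono; infer_instance
  epi := by have := h.epi; have := h'.epi; infer_instance
  zero := by ext <;> simp [h.zero, h'.zero]
  lift u hu := by
    obtain ⟨v, hv⟩ := h.lift (u ≫ biprod.fst) (by
      have := congrArg (· ≫ biprod.fst) hu
      simpa using this)
    obtain ⟨w, hw⟩ := h'.lift (u ≫ biprod.snd) (by
      have := congrArg (· ≫ biprod.snd) hu
      simpa using this)
    exact ⟨biprod.lift v w, by ext <;> simp [hv, hw]⟩
  desc u hu := by
    obtain ⟨v, hv⟩ := h.desc (biprod.inl ≫ u) (by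
      have := congrArg (biprod.inl ≫ ·) hu
      simpa using this)
    obtain ⟨w, hw⟩ := h'.desc (biprod.inr ≫ u) (by
      have := congrArg (biprod.inr ≫ ·) hu
      simpa using this)
    exact ⟨biprod.desc v w, by ext <;> simp [hv, hw]⟩

lemma DomC.biprod {Q : C} : ∀ {n : ℕ} {M N : C}, DomC Q n M → DomC Q n N → DomC Q n (M ⊞ N)
  | 0, _, _, _, _ => trivial
  | n + 1, M, N, hM, hN => by
    obtain ⟨X, K, f, p, hX, hS, hE, hK⟩ := hM
    obtain ⟨X', K', f', p', hX', hS', hE', hK'⟩ := hN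
    refine ⟨_, _, biprod.map f f', biprod.map p p', hX.biprod hX', hS.biprod hS', ?_, hK.biprod hK'⟩
    intro h
    obtain ⟨v, hv⟩ := hE (biprod.inl ≫ h)
    obtain ⟨w, hw⟩ := hE' (biprod.inr ≫ h)
    exact ⟨biprod.desc v w, by ext <;> simp [hv, hw]⟩

lemma DomC.of_mem {Q : C} : ∀ {n : ℕ} {M : C}, MemAddC Q M → DomC Q n M
  | 0, _, _ => trivial
  | n + 1, M, hM => by
    obtain ⟨Z, hZ⟩ := HasZeroObject.zero (C := C)
    refine ⟨M, Z, 𝟙 M, 0, hM, ⟨inferInstance, ?_, by simp, ?_, ?_⟩, fun h => ⟨h, by simp⟩,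
      DomC.of_mem (MemAddC.zero Q hZ)⟩
    · exact ⟨fun _ _ _ => hZ.eq_of_src _ _⟩
    · intro T u _; exact ⟨u, by simp⟩
    · intro T u hu; exact ⟨0, by simpa using hu.symm⟩

lemma DomC.retract {Q : C} (hC : ∀ {M X : C} (f : M ⟶ X), Mono f → ∃ (K : C) (p : X ⟶ K), SESC f p) :
    ∀ {n : ℕ} {M N : C} (i : N ⟶ M) (r : M ⟶ N), i ≫ r = 𝟙 N → DomC Q n M → DomC Q n N
  | 0, _, _, _, _, _, _ => trivial
  | n + 1, M, N, i, r, hir, hM => by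
    obtain ⟨X, K, f, p, hX, hS, hE, hK⟩ := hM
    have := hS.mono
    have hi : Mono i := by
      have : Mono (i ≫ r) := by rw [hir]; infer_instance
      exact mono_of_mono i r
    obtain ⟨K', p', hS'⟩ := hC (i ≫ f) inferInstance
    refine ⟨X, K', i ≫ f, p', hX, hS', ?_, ?_⟩
    · intro h
      obtain ⟨h', hh'⟩ := hE (r ≫ h)
      exact ⟨h', by rw [Category.assoc, hh', ← Category.assoc, hir, Category.id_comp]⟩
    · -- `r'` extends `r ≫ i ≫ f`
      obtain ⟨r', hr'⟩ := hX.ext f hE (r ≫ i ≫ f)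
      obtain ⟨ib, hib⟩ := hS'.desc p (by rw [Category.assoc, hS.zero, comp_zero])
      obtain ⟨rb, hrb⟩ := hS.desc (r' ≫ p') (by
        rw [← Category.assoc, hr', Category.assoc, hS'.zero, comp_zero])
      obtain ⟨s, hs⟩ := hS'.desc (𝟙 X - r') (by
        rw [Preadditive.comp_sub, Category.comp_id, Category.assoc, hr', ← Category.assoc i r, hir]; simp)
      refine DomC.retract hC (biprod.lift ib s) (biprod.desc rb p') ?_
        (hK.biprod (DomC.of_mem hX))
      have := hS'.epi
      rw [biprod.lift_desc, ← cancel_epi p', Preadditive.comp_add, ← Category.assoc, hib, hrb,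
        ← Category.assoc, hs]
      simp

lemma DomC.of_memAddC {Q M N : C} {n : ℕ}
    (hC : ∀ {M X : C} (f : M ⟶ X), Mono f → ∃ (K : C) (p : X ⟶ K), SESC f p)
    (hM : DomC Q n M) (hN : MemAddC M N) : DomC Q n N := by
  obtain ⟨ι, _, a, b, hab⟩ := hN
  classical
  suffices H : ∀ s : Finset ι, ∃ (Y : C) (i : N ⟶ Y) (r : Y ⟶ N), DomC Q n Y ∧
      i ≫ r = ∑ j ∈ s, a j ≫ b j by
    obtain ⟨Y, i, r, hY, h⟩ := H Finset.univ
    exact DomC.retract hC i r (h.trans hab) hY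
  intro s
  induction s using Finset.induction_on with
  | empty =>
    obtain ⟨Z, hZ⟩ := HasZeroObject.zero (C := C)
    exact ⟨Z, 0, 0, DomC.of_mem (MemAddC.zero Q hZ), by simp⟩
  | insert j s hj ih =>
    obtain ⟨Y, i, r, hY, h⟩ := ih
    exact ⟨M ⊞ Y, biprod.lift (a j) i, biprod.desc (b j) r, hM.biprod hY, by
      rw [biprod.lift_desc, h, Finset.sum_insert hj]⟩

end

section
variable {C : Type u1} [Category.{v1} C] [Preadditive C]
variable {D : Type u2} [Category.{v2} D] [Preadditive D]
variable (F : C ⥤ D) [F.IsEquivalence] [F.Additive]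

lemma MemAddC.mapF {Q X : C} (h : MemAddC Q X) : MemAddC (F.obj Q) (F.obj X) := by
  obtain ⟨ι, _, a, b, hab⟩ := h
  refine ⟨ι, inferInstance, fun j => F.map (a j), fun j => F.map (b j), ?_⟩
  simp only [← F.map_comp]
  rw [← F.map_sum, hab, F.map_id]

lemma SESC.mapF {M X K : C} {f : M ⟶ X} {p : X ⟶ K} (h : SESC f p) :
    SESC (F.map f) (F.map p) where
  mono := by have := h.mono; infer_instance
  epi := by have := h.epi; infer_instance
  zero := by rw [← F.map_comp, h.zero, F.map_zero]
  lift {T} u hu := by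
    let e := F.objObjPreimageIso T
    obtain ⟨u', hu'⟩ := F.map_surjective (e.hom ≫ u)
    obtain ⟨v, hv⟩ := h.lift u' (F.map_injective (by
      rw [F.map_comp, hu', Category.assoc, hu, comp_zero, F.map_zero]))
    exact ⟨e.inv ≫ F.map v, by rw [Category.assoc, ← F.map_comp, hv, hu']; simp⟩
  desc {T} u hu := by
    let e := F.objObjPreimageIso T
    obtain ⟨u', hu'⟩ := F.map_surjective (u ≫ e.inv)
    obtain ⟨v, hv⟩ := h.desc u' (F.map_injective (by
      rw [F.map_comp, hu', ← Category.assoc, hu, zero_comp, F.map_zero]))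
    exact ⟨F.map v ≫ e.hom, by rw [← Category.assoc, ← F.map_comp, hv, hu']; simp⟩

lemma DomC.mapF {Q : C} : ∀ {n : ℕ} {M : C}, DomC Q n M → DomC (F.obj Q) n (F.obj M)
  | 0, _, _ => trivial
  | n + 1, M, hM => by
    obtain ⟨X, K, f, p, hX, hS, hE, hK⟩ := hM
    refine ⟨_, _, F.map f, F.map p, hX.mapF F, hS.mapF F, ?_, hK.mapF⟩
    intro h
    obtain ⟨h, rfl⟩ := F.map_surjective h
    obtain ⟨h', rfl⟩ := hE h
    exact ⟨F.map h', by simp⟩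

lemma PDC.mapF : ∀ {n : ℕ} {M : C}, PDC n M → PDC n (F.obj M)
  | 0, M, h => (F.asEquivalence.map_projective_iff M).2 h
  | n + 1, M, hM => by
    obtain ⟨K, P, f, p, hP, hS, hK⟩ := hM
    exact ⟨_, _, F.map f, F.map p, (F.asEquivalence.map_projective_iff P).2 hP, hS.mapF F, hK.mapF⟩

end
end AuxCat
section AuxMod
open CategoryTheory CategoryTheory.Limits

variable {R : Type u} [Ring R]

abbrev lm {X Y : FGModuleCat.{u} R} (f : X ⟶ Y) : X →ₗ[R] Y := f.hom.hom

lemma lm_sum {X Y : FGModuleCat.{u} R} {ι : Type} (s : Finset ι) (f : ι → (X ⟶ Y)) :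
    lm (∑ j ∈ s, f j) = ∑ j ∈ s, lm (f j) := by
  classical
  induction s using Finset.induction_on with
  | empty => simp; rfl
  | insert j s hj ih => rw [Finset.sum_insert hj, Finset.sum_insert hj, ← ih]; rfl

def mkHom {X Y : FGModuleCat.{u} R} (f : X →ₗ[R] Y) : X ⟶ Y := ⟨ModuleCat.ofHom f⟩

@[simp] lemma lm_mkHom {X Y : FGModuleCat.{u} R} (f : X →ₗ[R] Y) : lm (mkHom f) = f := rfl

lemma lm_ext {X Y : FGModuleCat.{u} R} {f g : X ⟶ Y} (h : lm f = lm g) : f = g :=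
  FGModuleCat.hom_ext h

lemma mono_inj {X Y : FGModuleCat.{u} R} (f : X ⟶ Y) : Mono f ↔ Function.Injective (lm f) := by
  constructor
  · intro _
    rw [injective_iff_map_eq_zero]
    intro x hx
    have h : (mkHom (X := FGModuleCat.of R R) (LinearMap.toSpanSingleton R X x)) = 0 := by
      rw [← cancel_mono f, zero_comp]
      apply lm_ext
      apply LinearMap.ext_ring
      change lm f ((1 : R) • x) = 0
      rw [one_smul, hx]
    have := congrArg (fun g => lm g (1 : R)) h
    change (1 : R) • x = 0 at this
    simpa using this
  · intro h
    exact ⟨fun a b hab => lm_ext (LinearMap.ext fun x => h (congrArg (fun g => lm g x) hab))⟩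

lemma epi_surj {X Y : FGModuleCat.{u} R} (f : X ⟶ Y) : Epi f ↔ Function.Surjective (lm f) := by
  constructor
  · intro _
    have h : (mkHom (Y := FGModuleCat.of R (Y ⧸ LinearMap.range (lm f)))
      (LinearMap.range (lm f)).mkQ) = 0 := by
      rw [← cancel_epi f]
      apply lm_ext
      ext x
      exact (Submodule.Quotient.mk_eq_zero _).2 ⟨x, rfl⟩
    intro y
    have := congrArg (fun g => lm g y) h
    exact (Submodule.Quotient.mk_eq_zero _).1 this
  · intro h
    exact ⟨fun a b hab => lm_ext (LinearMap.ext fun x => by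
      obtain ⟨x, rfl⟩ := h x
      exact (congrArg (fun g => lm g x) hab))⟩

lemma sesc_iff {M X K : FGModuleCat.{u} R} (f : M ⟶ X) (p : X ⟶ K) :
    SESC f p ↔ Function.Injective (lm f) ∧ Function.Surjective (lm p) ∧
      Function.Exact (lm f) (lm p) := by
  constructor
  · intro h
    refine ⟨(mono_inj f).1 h.mono, (epi_surj p).1 h.epi, fun x => ⟨fun hx => ?_, ?_⟩⟩
    · obtain ⟨v, hv⟩ := h.lift (mkHom (X := FGModuleCat.of R R) (LinearMap.toSpanSingleton R X x)) (by
        apply lm_ext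
        apply LinearMap.ext_ring
        change lm p ((1 : R) • x) = 0
        rw [one_smul, hx])
      have := congrArg (fun g => lm g (1 : R)) hv
      refine ⟨lm v (1 : R), this.trans (one_smul R x)⟩
    · rintro ⟨m, rfl⟩
      exact congrArg (fun g => lm g m) h.zero
  · rintro ⟨h1, h2, h3⟩
    refine ⟨(mono_inj f).2 h1, (epi_surj p).2 h2, ?_, ?_, ?_⟩
    · apply lm_ext; ext x; exact (h3 _).2 ⟨x, rfl⟩
    · intro T u hu
      have hr : ∀ t, lm u t ∈ LinearMap.range (lm f) := fun t =>
        (h3 _).1 (congrArg (fun g => lm g t) hu)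
      refine ⟨mkHom ((LinearEquiv.ofInjective (lm f) h1).symm.toLinearMap ∘ₗ
        (lm u).codRestrict _ hr), ?_⟩
      apply lm_ext; ext t
      exact congrArg Subtype.val
        ((LinearEquiv.ofInjective (lm f) h1).apply_symm_apply ⟨lm u t, hr t⟩)
    · intro T u hu
      have hk : LinearMap.ker (lm p) ≤ LinearMap.ker (lm u) := by
        intro x hx
        obtain ⟨m, rfl⟩ := (h3 x).1 hx
        exact congrArg (fun g => lm g m) hu
      refine ⟨mkHom ((Submodule.liftQ _ (lm u) hk) ∘ₗ
        ((lm p).quotKerEquivOfSurjective h2).symm.toLinearMap), ?_⟩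
      apply lm_ext; ext x
      change Submodule.liftQ _ (lm u) hk (((lm p).quotKerEquivOfSurjective h2).symm (lm p x)) = lm u x
      have : ((lm p).quotKerEquivOfSurjective h2).symm (lm p x) = Submodule.Quotient.mk x := by
        rw [LinearEquiv.symm_apply_eq]; rfl
      rw [this]; rfl

lemma exists_sesc {M X : FGModuleCat.{u} R} (f : M ⟶ X) (hf : Mono f) :
    ∃ (K : FGModuleCat.{u} R) (p : X ⟶ K), SESC f p := by
  refine ⟨FGModuleCat.of R (X ⧸ LinearMap.range (lm f)), mkHom (LinearMap.range (lm f)).mkQ, ?_⟩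
  rw [sesc_iff]
  refine ⟨(mono_inj f).1 hf, Submodule.mkQ_surjective _, fun x => ?_⟩
  exact Submodule.Quotient.mk_eq_zero _

lemma memAdd_iff' (Q X : Type u) [AddCommGroup Q] [Module R Q] [AddCommGroup X] [Module R X] :
    MemAdd R Q X ↔ ∃ (m : ℕ) (a : Fin m → (X →ₗ[R] Q)) (b : Fin m → (Q →ₗ[R] X)),
      ∑ j, b j ∘ₗ a j = LinearMap.id := by
  constructor
  · rintro ⟨m, Y, _, _, ⟨e⟩⟩
    refine ⟨m, fun j => LinearMap.proj j ∘ₗ e.toLinearMap ∘ₗ LinearMap.inl R X Y,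
      fun j => LinearMap.fst R X Y ∘ₗ e.symm.toLinearMap ∘ₗ LinearMap.single R (fun _ => Q) j, ?_⟩
    ext x
    simp only [LinearMap.sum_apply, LinearMap.comp_apply]
    rw [← map_sum, LinearEquiv.coe_coe, ← map_sum]
    have : ∑ j, (LinearMap.single R (fun _ : Fin m => Q) j)
        ((LinearMap.proj j : (Fin m → Q) →ₗ[R] Q) (e.toLinearMap (LinearMap.inl R X Y x)))
        = e.toLinearMap (LinearMap.inl R X Y x) := by
      exact Finset.univ_sum_single (e.toLinearMap (LinearMap.inl R X Y x))
    erw [this]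
    simp
  · rintro ⟨m, a, b, hab⟩
    let i : X →ₗ[R] (Fin m → Q) := LinearMap.pi a
    let r : (Fin m → Q) →ₗ[R] X := ∑ j, b j ∘ₗ LinearMap.proj j
    have hri : r ∘ₗ i = LinearMap.id := by
      rw [← hab]; ext x; simp [r, i]
    have hri' : ∀ x, r (i x) = x := fun x => congrArg (fun g => g x) hri
    refine ⟨m, LinearMap.ker r, inferInstance, inferInstance, ⟨?_⟩⟩
    have hk : ∀ c, (LinearMap.id - i ∘ₗ r : (Fin m → Q) →ₗ[R] (Fin m → Q)) c ∈ LinearMap.ker r := by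
      intro c
      rw [LinearMap.mem_ker, LinearMap.sub_apply, map_sub]
      simp only [LinearMap.comp_apply, hri', LinearMap.id_apply, sub_self]
    refine LinearEquiv.ofLinearMap (i.coprod (LinearMap.ker r).subtype)
      (r.prod ((LinearMap.id - i ∘ₗ r).codRestrict _ hk)) ?_ ?_
    · refine LinearMap.ext fun c => ?_
      change i (r c) + (c - i (r c)) = c
      abel
    · refine LinearMap.ext fun ⟨x, y, hy⟩ => ?_
      have hy' : r y = 0 := hy
      have h1 : r (i x + y) = x := by rw [map_add, hri', hy', add_zero]
      refine Prod.ext h1 (Subtype.ext ?_)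
      change (i x + y) - i (r (i x + y)) = y
      rw [h1]; abel

lemma memAddC_iff (Q X : FGModuleCat.{u} R) : MemAddC Q X ↔ MemAdd R Q X := by
  rw [memAdd_iff']
  constructor
  · rintro ⟨ι, _, a, b, hab⟩
    let e := (Fintype.equivFin ι).symm
    refine ⟨_, fun j => lm (a (e j)), fun j => lm (b (e j)), ?_⟩
    rw [e.sum_comp (fun j => lm (b j) ∘ₗ lm (a j))]
    have := congrArg lm hab
    rw [lm_sum] at this
    exact this
  · rintro ⟨m, a, b, hab⟩
    refine ⟨Fin m, inferInstance, fun j => mkHom (a j), fun j => mkHom (b j), ?_⟩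
    apply lm_ext
    rw [lm_sum]
    exact hab

lemma MemAdd.finite {Q X : Type u} [AddCommGroup Q] [Module R Q] [AddCommGroup X] [Module R X]
    [Module.Finite R Q] (h : MemAdd R Q X) : Module.Finite R X := by
  obtain ⟨m, Y, _, _, ⟨e⟩⟩ := h
  exact Module.Finite.of_surjective (LinearMap.fst R X Y ∘ₗ e.symm.toLinearMap)
    ((LinearMap.fst_surjective (R := R) (M := X) (M₂ := Y)).comp e.symm.surjective)

lemma proj_iff (P : FGModuleCat.{u} R) : Projective P ↔ Module.Projective R P := by
  constructor
  · intro _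
    obtain ⟨m, f, hf⟩ := Module.Finite.exists_fin' R P
    let g : FGModuleCat.of R (Fin m → R) ⟶ P := mkHom f
    have : Epi g := (epi_surj g).2 hf
    refine Module.Projective.of_split (lm (Projective.factorThru (𝟙 P) g)) f ?_
    exact congrArg lm (Projective.factorThru_comp (𝟙 P) g)
  · intro _
    refine ⟨fun {E X} f e he => ?_⟩
    obtain ⟨h, hh⟩ := Module.projective_lifting_property (lm e) (lm f) ((epi_surj e).1 he)
    exact ⟨mkHom h, lm_ext hh⟩

end AuxMod
section AuxTransfer
open CategoryTheory CategoryTheory.Limits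

variable {R : Type u} [Ring R]

lemma dom_fwd (Q : FGModuleCat.{u} R) : ∀ (n : ℕ) (M : FGModuleCat.{u} R),
    RelDomdimGE R Q M n → DomC Q n M
  | 0, _, _ => trivial
  | n + 1, M, h => by
    rcases h with h | ⟨X, _, _, f, d, hmem, hinj, hex1, hex, hs, hq1, hq⟩
    · omega
    have hfin : Module.Finite R (X 1) := (hmem 1 le_rfl (by omega)).finite
    refine ⟨FGModuleCat.of R (X 1), FGModuleCat.of R (X 1 ⧸ LinearMap.range f),
      mkHom (Y := FGModuleCat.of R (X 1)) f,
      mkHom (X := FGModuleCat.of R (X 1)) (Y := FGModuleCat.of R (X 1 ⧸ LinearMap.range f))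
        (LinearMap.range f).mkQ, ?_, ?_, ?_, dom_fwd Q n _ ?_⟩
    · rw [memAddC_iff]; exact hmem 1 le_rfl (by omega)
    · rw [sesc_iff]
      refine ⟨hinj, Submodule.mkQ_surjective _, fun x => ?_⟩
      exact Submodule.Quotient.mk_eq_zero _
    · intro h
      obtain ⟨h', hh'⟩ := hs (lm h)
      exact ⟨mkHom (X := FGModuleCat.of R (X 1)) h', lm_ext hh'⟩
    · rcases Nat.eq_zero_or_pos n with hn | hn
      · exact Or.inl hn
      have hx1 := hex1 (by omega)
      have hle : LinearMap.range f ≤ LinearMap.ker (d 1) := by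
        rintro _ ⟨x, rfl⟩
        exact (hx1 _).2 ⟨x, rfl⟩
      let f' : (X 1 ⧸ LinearMap.range f) →ₗ[R] X 2 := (LinearMap.range f).liftQ (d 1) hle
      have hf' : ∀ x, f' (Submodule.Quotient.mk x) = d 1 x := fun x => rfl
      have hcomp : ∀ g : X 2 →ₗ[R] Q, g.comp f' = 0 ↔ g.comp (d 1) = 0 := by
        intro g
        constructor
        · intro h
          ext x
          exact congrArg (fun t => t (Submodule.Quotient.mk x)) h
        · intro h
          ext x
          exact congrArg (fun t => t x) h
      refine Or.inr ⟨fun i => X (i + 1), inferInstance, inferInstance, f', fun i => d (i + 1),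
        fun i h1 h2 => hmem (i + 1) (by omega) (by omega), ?_, ?_,
        fun i h1 h2 => hex (i + 1) (by omega) (by omega), ?_, ?_,
        fun i h1 h2 => hq (i + 1) (by omega) (by omega)⟩
      · rw [injective_iff_map_eq_zero]
        intro a ha
        obtain ⟨x, rfl⟩ := Submodule.Quotient.mk_surjective _ a
        exact (Submodule.Quotient.mk_eq_zero _).2 ((hx1 x).1 ha)
      · intro h2 y
        rw [hex 1 le_rfl (by omega) y]
        constructor
        · rintro ⟨x, rfl⟩; exact ⟨Submodule.Quotient.mk x, rfl⟩
        · rintro ⟨a, rfl⟩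
          obtain ⟨x, rfl⟩ := Submodule.Quotient.mk_surjective _ a
          exact ⟨x, rfl⟩
      · intro h
        obtain ⟨h', hh'⟩ := (hq1 (by omega) (h.comp (LinearMap.range f).mkQ)).1 (by
          ext m
          change h (Submodule.Quotient.mk (f m)) = 0
          have h0 : (Submodule.Quotient.mk (f m) : X 1 ⧸ LinearMap.range f) = 0 :=
            (Submodule.Quotient.mk_eq_zero _).2 ⟨m, rfl⟩
          exact (congrArg h h0).trans (map_zero h))
        refine ⟨h', ?_⟩
        ext x
        exact congrArg (fun t => t x) hh'
      · intro h2 g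
        exact (hcomp g).trans (hq 1 le_rfl (by omega) g)

def seqT (X : Type u) (X' : ℕ → Type u) : ℕ → Type u
  | 0 => X
  | 1 => X
  | (i + 2) => X' (i + 1)

instance seqG (X : Type u) (X' : ℕ → Type u) [AddCommGroup X] [∀ i, AddCommGroup (X' i)] :
    ∀ i, AddCommGroup (seqT X X' i)
  | 0 => inferInstanceAs (AddCommGroup X)
  | 1 => inferInstanceAs (AddCommGroup X)
  | (i + 2) => inferInstanceAs (AddCommGroup (X' (i + 1)))

instance seqM (X : Type u) (X' : ℕ → Type u) [AddCommGroup X] [∀ i, AddCommGroup (X' i)]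
    [Module R X] [∀ i, Module R (X' i)] :
    ∀ i, Module R (seqT X X' i)
  | 0 => inferInstanceAs (Module R X)
  | 1 => inferInstanceAs (Module R X)
  | (i + 2) => inferInstanceAs (Module R (X' (i + 1)))

def seqD (X : Type u) (X' : ℕ → Type u) [AddCommGroup X] [∀ i, AddCommGroup (X' i)]
    [Module R X] [∀ i, Module R (X' i)] (g : X →ₗ[R] X' 1) (d : ∀ i, X' i →ₗ[R] X' (i + 1)) :
    ∀ i, seqT X X' i →ₗ[R] seqT X X' (i + 1)
  | 0 => 0
  | 1 => g
  | (i + 2) => d (i + 1)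

lemma dom_back (Q : FGModuleCat.{u} R) : ∀ (n : ℕ) (M : FGModuleCat.{u} R),
    DomC Q n M → RelDomdimGE R Q M n
  | 0, _, _ => Or.inl rfl
  | n + 1, M, h => by
    obtain ⟨X, K, f, p, hX, hS, hE, hK⟩ := h
    rw [memAddC_iff] at hX
    rw [sesc_iff] at hS
    obtain ⟨hinj, hsurj, hexact⟩ := hS
    have hs : Function.Surjective (fun h : X →ₗ[R] Q => h.comp (lm f)) := by
      intro h
      obtain ⟨h', hh'⟩ := hE (mkHom h)
      exact ⟨lm h', congrArg lm hh'⟩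
    rcases dom_back Q n K hK with hn | ⟨X', _, _, f', d', hmem, hinj', hex1, hex, hs', hq1, hq⟩
    · subst hn
      refine Or.inr ⟨fun _ => X, inferInstance, inferInstance, lm f, fun _ => 0, fun _ _ _ => hX,
        hinj, by omega, by intros; omega, hs, by omega, by intros; omega⟩
    · refine Or.inr ⟨seqT X X', seqG _ _, seqM _ _, lm f, seqD X X' (f' ∘ₗ lm p) d', ?_, hinj,
        ?_, ?_, hs, ?_, ?_⟩
      · intro i h1 h2
        match i, h1, h2 with
        | 1, _, _ => exact hX
        | i + 2, _, _ => exact hmem (i + 1) (by omega) (by omega)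
      · intro _ x
        refine Iff.trans ?_ (hexact x)
        exact ⟨fun h => hinj' (h.trans (map_zero f').symm),
          fun h => (congrArg f' h).trans (map_zero f')⟩
      · intro i h1 h2
        match i, h1, h2 with
        | 1, _, _ =>
          intro y
          refine (hex1 (by omega) y).trans ?_
          constructor
          · rintro ⟨a, rfl⟩
            obtain ⟨x, rfl⟩ := hsurj a
            exact ⟨x, rfl⟩
          · rintro ⟨x, rfl⟩
            exact ⟨lm p x, rfl⟩
        | i + 2, _, _ => exact hex (i + 1) (by omega) (by omega)
      · intro _ (g : X →ₗ[R] Q)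
        constructor
        · intro (hg : g.comp (lm f) = 0)
          have hk : LinearMap.ker (lm p) ≤ LinearMap.ker g := by
            intro x hx
            obtain ⟨m, rfl⟩ := (hexact x).1 hx
            exact congrArg (fun t => t m) hg
          obtain ⟨v, hv⟩ := ((sesc_iff f p).2 ⟨hinj, hsurj, hexact⟩).desc (mkHom g) (lm_ext hg)
          obtain ⟨h', hh'⟩ := hs' (lm v)
          refine ⟨h', ?_⟩
          have h1 : (lm v).comp (lm p) = g := congrArg lm hv
          have h2 : h'.comp f' = lm v := hh'
          rw [← h2] at h1
          exact h1
        · rintro ⟨h, rfl⟩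
          refine LinearMap.ext fun m => ?_
          change h (f' (lm p (lm f m))) = 0
          rw [(hexact (lm f m)).2 ⟨m, rfl⟩, map_zero]
          exact map_zero h
      · intro i h1 h2
        match i, h1, h2 with
        | 1, _, _ =>
          intro (g : X' 1 →ₗ[R] Q)
          refine Iff.trans ?_ (hq1 (by omega) g)
          constructor
          · intro h
            refine LinearMap.ext fun a => ?_
            obtain ⟨x, rfl⟩ := hsurj a
            exact congrArg (fun t : X →ₗ[R] Q => t x) h
          · intro h
            refine LinearMap.ext fun x => ?_
            exact congrArg (fun t => t (lm p x)) h
        | i + 2, _, _ => exact hq (i + 1) (by omega) (by omega)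

lemma shortExact_of {K P M : Type u} [AddCommGroup K] [Module R K] [AddCommGroup P] [Module R P]
    [AddCommGroup M] [Module R M] (f : K →ₗ[R] P) (g : P →ₗ[R] M) (h1 : Function.Injective f)
    (h2 : Function.Surjective g) (h3 : Function.Exact f g) :
    (ShortComplex.mk (ModuleCat.ofHom f) (ModuleCat.ofHom g)
      (ModuleCat.hom_ext h3.linearMap_comp_eq_zero)).ShortExact where
  exact := (ShortComplex.ShortExact.moduleCat_exact_iff_function_exact _).2 h3
  mono_f := (ModuleCat.mono_iff_injective _).2 h1
  epi_g := (ModuleCat.epi_iff_surjective _).2 h2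

lemma pd_fwd1 : ∀ (n : ℕ) (M : Type u) [AddCommGroup M] [Module R M],
    PDimLE R n M → HasProjectiveDimensionLT (ModuleCat.of R M) (n + 1)
  | 0, M, _, _, h => by
    have h' : Module.Projective R M := h
    rw [← projective_iff_hasProjectiveDimensionLT_one]
    exact (IsProjective.iff_projective M).1 h'
  | n + 1, M, _, _, h => by
    obtain ⟨P, _, _, f, hP, hf, hK⟩ := h
    have hS := shortExact_of (LinearMap.ker f).subtype f (Submodule.subtype_injective _) hf
      (LinearMap.exact_subtype_ker_map f)
    exact (hS.hasProjectiveDimensionLT_X₃_iff n ((IsProjective.iff_projective P).1 hP)).2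
      (pd_fwd1 n _ hK)

lemma pd_fwd2 [IsNoetherianRing R] : ∀ (n : ℕ) (M : FGModuleCat.{u} R),
    HasProjectiveDimensionLT (ModuleCat.of R M) (n + 1) → PDC n M
  | 0, M, h => by
    rw [← projective_iff_hasProjectiveDimensionLT_one] at h
    exact (proj_iff M).2 ((IsProjective.iff_projective _).2 h)
  | n + 1, M, h => by
    obtain ⟨m, f, hf⟩ := Module.Finite.exists_fin' R M
    have hS := shortExact_of (LinearMap.ker f).subtype f (Submodule.subtype_injective _) hf
      (LinearMap.exact_subtype_ker_map f)
    have hP : Module.Projective R (Fin m → R) := inferInstance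
    have hK := (hS.hasProjectiveDimensionLT_X₃_iff n ((IsProjective.iff_projective _).1 hP)).1 h
    refine ⟨FGModuleCat.of R (LinearMap.ker f), FGModuleCat.of R (Fin m → R),
      mkHom (X := FGModuleCat.of R (LinearMap.ker f)) (Y := FGModuleCat.of R (Fin m → R))
        (LinearMap.ker f).subtype, mkHom (X := FGModuleCat.of R (Fin m → R)) f,
      (proj_iff _).2 hP, ?_, pd_fwd2 n _ hK⟩
    rw [sesc_iff]
    exact ⟨Submodule.subtype_injective _, hf, LinearMap.exact_subtype_ker_map f⟩

lemma pd_back : ∀ (n : ℕ) (M : FGModuleCat.{u} R) (N : Type u) [AddCommGroup N] [Module R N]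
    (_ : M ≃ₗ[R] N), PDC n M → PDimLE R n N
  | 0, M, N, _, _, e, h => by
    have := (proj_iff M).1 h
    exact Module.Projective.of_equiv e
  | n + 1, M, N, _, _, e, h => by
    obtain ⟨K, P, f, p, hP, hS, hK⟩ := h
    rw [sesc_iff] at hS
    obtain ⟨hinj, hsurj, hexact⟩ := hS
    refine ⟨P, inferInstance, inferInstance, e.toLinearMap ∘ₗ lm p, (proj_iff P).1 hP,
      e.surjective.comp hsurj, pd_back n K _ ?_ hK⟩
    refine (LinearEquiv.ofInjective (lm f) hinj).trans (LinearEquiv.ofEq _ _ ?_)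
    rw [LinearEquiv.ker_comp]
    exact hexact.linearMap_ker_eq.symm

lemma memAddC_of_projective (P : FGModuleCat.{u} R) (hP : Projective P) :
    MemAddC (FGModuleCat.of R R) P := by
  have := (proj_iff P).1 hP
  obtain ⟨m, f, hf⟩ := Module.Finite.exists_fin' R P
  obtain ⟨g, hg⟩ := Module.projective_lifting_property f LinearMap.id hf
  rw [memAddC_iff, memAdd_iff']
  refine ⟨m, fun j => LinearMap.proj j ∘ₗ g, fun j => f ∘ₗ LinearMap.single R (fun _ => R) j, ?_⟩
  ext x
  simp only [LinearMap.sum_apply, LinearMap.comp_apply]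
  rw [← map_sum]
  have : ∑ j, (LinearMap.single R (fun _ : Fin m => R) j)
        ((LinearMap.proj j : (Fin m → R) →ₗ[R] R) (g x)) = g x :=
    Finset.univ_sum_single (g x)
  erw [this]
  exact congrArg (fun t => t x) hg

end AuxTransfer

open CategoryTheory in
/-- Let `A` and `B` be finite-dimensional algebras over a field `k`,
`F : A-mod → B-mod` an equivalence between their categories of finitely generated left
modules, `Q` a finitely generated `A`-module and `n : ℕ`. If `(A, Q)` is an `n`-Auslander
pair (`gldim A ≤ n ≤ Q-domdim_A A`), then `(B, FQ)` is an `n`-Auslander pair. -/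
theorem auslander_pair_invariant_equivalence (k : Type u) [Field k] (A B : Type u)
    [Ring A] [Ring B] [Algebra k A] [Algebra k B] [FiniteDimensional k A]
    [FiniteDimensional k B] (F : FGModuleCat A ⥤ FGModuleCat B) [F.IsEquivalence]
    (Q : FGModuleCat A) (n : ℕ)
    (hgl : ∀ (M : Type u) [AddCommGroup M] [Module A M], Module.Finite A M →
      PDimLE A n M)
    (hdom : RelDomdimGE A ↥Q A n) :
    (∀ (M : Type u) [AddCommGroup M] [Module B M], Module.Finite B M → PDimLE B n M) ∧
    RelDomdimGE B ↥(F.obj Q) B n := by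
  have hA : IsNoetherianRing A := isNoetherian_of_tower k inferInstance
  have hB : IsNoetherianRing B := isNoetherian_of_tower k inferInstance
  have hadd : F.Additive := F.additive_of_preserves_binary_products
  constructor
  · intro M _ _ hM
    let X : FGModuleCat A := F.objPreimage (FGModuleCat.of B M)
    let e : F.obj X ≅ FGModuleCat.of B M := F.objObjPreimageIso (FGModuleCat.of B M)
    exact pd_back n (F.obj X) M (FGModuleCat.isoToLinearEquiv e)
      (PDC.mapF F (pd_fwd2 n X (pd_fwd1 n X (hgl X inferInstance))))
  · let X : FGModuleCat A := F.objPreimage (FGModuleCat.of B B)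
    let e : F.obj X ≅ FGModuleCat.of B B := F.objObjPreimageIso (FGModuleCat.of B B)
    have hPB : Projective (FGModuleCat.of B B) :=
      (proj_iff (FGModuleCat.of B B)).2 (inferInstanceAs (Module.Projective B B))
    have hPX : Projective X := (F.asEquivalence.map_projective_iff X).1
      (Projective.of_iso e.symm hPB)
    have h1 : DomC Q n (FGModuleCat.of A A) := dom_fwd Q n (FGModuleCat.of A A) hdom
    have h2 : DomC Q n X := DomC.of_memAddC exists_sesc h1 (memAddC_of_projective X hPX)
    have h3 : DomC (F.obj Q) n (F.obj X) := h2.mapF F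
    have h4 : DomC (F.obj Q) n (FGModuleCat.of B B) :=
      DomC.retract exists_sesc e.inv e.hom e.inv_hom_id h3
    exact dom_back (F.obj Q) n (FGModuleCat.of B B) h4
end
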